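/- arXiv:1906.07648 — 3 statements merged into one kernel-verified Lean document; each statement's English description precedes it below -/
import Mathlib

section
/- For every k ≥ 3, if S is a tournament on s ≥ r(k−1) vertices, then S has a fractional T_{k−1}-tiling of size at least (s − (r(k−1) − k + 1))/(k − 1). -/
open Finset

/-- An oriented graph: at most one directed edge between any pair of vertices. -/
structure OrientedGraph (V : Type*) where
  adj : V → V → Prop
  asymm : ∀ u v, adj u v → ¬ adj v u

namespace OrientedGraph

variable {V : Type*}

/-- A tournament: a complete oriented graph. -/
def IsTournament (G : OrientedGraph V) : Prop :=
  ∀ u v : V, u ≠ v → G.adj u v ∨ G.adj v u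

/-- `U` is the vertex set of a copy of the transitive tournament on `k` vertices in `G`. -/
def IsTTCopy (G : OrientedGraph V) (k : ℕ) (U : Finset V) : Prop :=
  ∃ f : Fin k ↪ V, Finset.univ.map f = U ∧
    ∀ i j : Fin k, i < j → G.adj (f i) (f j)

/-- Total degree of a vertex: the number of edges incident to it. -/
noncomputable def degree [Fintype V] (G : OrientedGraph V) (v : V) : ℕ :=
  Nat.card {u : V // G.adj v u ∨ G.adj u v}

/-- Minimum total degree. -/
noncomputable def minDegree [Fintype V] (G : OrientedGraph V) : ℕ :=
  sInf (Set.range G.degree)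

/-- Number of (directed) edges. -/
noncomputable def edgeCount [Fintype V] (G : OrientedGraph V) : ℕ :=
  Nat.card {p : V × V // G.adj p.1 p.2}

section
variable [Fintype V] [DecidableEq V]

/-- A fractional `T_k`-tiling: a weight function on copies of the transitive tournament
`T_k` such that every vertex has total incident weight at most `1`. -/
def IsFracTiling (G : OrientedGraph V) (k : ℕ) (w : Finset V → ℝ) : Prop :=
  (∀ U, 0 ≤ w U) ∧ (∀ U, ¬ G.IsTTCopy k U → w U = 0) ∧
    ∀ v : V, ∑ U ∈ Finset.univ.filter (fun U => v ∈ U), w U ≤ 1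

/-- A perfect fractional `T_k`-tiling: total weight `n/k`. -/
def HasPerfectFracTiling (G : OrientedGraph V) (k : ℕ) : Prop :=
  ∃ w : Finset V → ℝ, G.IsFracTiling k w ∧
    ∑ U : Finset V, w U = (Fintype.card V : ℝ) / k

/-- A perfect `T_k`-tiling: vertex-disjoint copies of `T_k` covering all vertices. -/
def HasPerfectTiling (G : OrientedGraph V) (k : ℕ) : Prop :=
  ∃ P : Finset (Finset V), (∀ U ∈ P, G.IsTTCopy k U) ∧
    (P : Set (Finset V)).PairwiseDisjoint id ∧ P.sup id = Finset.univ

end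

end OrientedGraph

/-- The oriented Ramsey number `r(k)`: the least `m` such that every tournament on `m`
vertices contains a copy of the transitive tournament `T_k`. -/
noncomputable def oRamsey (k : ℕ) : ℕ :=
  sInf {m | ∀ G : OrientedGraph (Fin m), G.IsTournament → ∃ U, G.IsTTCopy k U}

/-- `trs k`: the least (positive) `n` such that every tournament on `n` vertices has a
perfect fractional `T_k`-tiling. -/
noncomputable def trs (k : ℕ) : ℕ :=
  sInf {n | 0 < n ∧ ∀ G : OrientedGraph (Fin n), G.IsTournament → G.HasPerfectFracTiling k}

/-- `trInt k`: the least (positive) `n` such that every tournament on `n` vertices has a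
perfect `T_k`-tiling. -/
noncomputable def trInt (k : ℕ) : ℕ :=
  sInf {n | 0 < n ∧ ∀ G : OrientedGraph (Fin n), G.IsTournament → G.HasPerfectTiling k}

namespace OrientedGraph

variable {V : Type*}

/-- A list whose entries dominate all later entries is a copy of a transitive tournament. -/
theorem IsTTCopy.of_pairwise [DecidableEq V] (G : OrientedGraph V) {l : List V}
    (hl : l.Pairwise G.adj) : G.IsTTCopy l.length l.toFinset := by
  have hadj : ∀ i j : Fin l.length, i < j → G.adj (l.get i) (l.get j) := fun i j hij =>
    List.pairwise_iff_get.1 hl i j hij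
  have hinj : Function.Injective l.get := by
    intro i j hij
    by_contra hne
    rcases lt_or_gt_of_ne hne with h | h
    · have := hadj i j h
      rw [hij] at this
      exact G.asymm _ _ this this
    · have := hadj j i h
      rw [hij] at this
      exact G.asymm _ _ this this
  refine ⟨⟨l.get, hinj⟩, ?_, hadj⟩
  ext x
  simp [List.mem_iff_get]

/-- Every set of `2 ^ t` vertices of a tournament contains a transitive list of length `t`. -/
theorem exists_pairwise_of_two_pow_le_card [DecidableEq V] {G : OrientedGraph V}
    (hG : G.IsTournament) (t : ℕ) (A : Finset V) (hA : 2 ^ t ≤ A.card) :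
    ∃ l : List V, l.length = t ∧ (∀ x ∈ l, x ∈ A) ∧ l.Pairwise G.adj := by
  classical
  induction t generalizing A with
  | zero => exact ⟨[], by simp⟩
  | succ t ih =>
    have hpos : 0 < A.card := lt_of_lt_of_le (by positivity) hA
    obtain ⟨v, hv⟩ := Finset.card_pos.1 hpos
    have hcover : A.erase v ⊆ A.filter (G.adj v) ∪ A.filter (fun u => G.adj u v) := by
      intro u hu
      obtain ⟨huv, huA⟩ := Finset.mem_erase.1 hu
      rcases hG u v huv with h | h <;> simp [huA, h]
    have hcard := (Finset.card_le_card hcover).trans (Finset.card_union_le _ _)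
    rw [Finset.card_erase_of_mem hv] at hcard
    rw [pow_succ] at hA
    by_cases hout : 2 ^ t ≤ (A.filter (G.adj v)).card
    · obtain ⟨l, hlen, hmem, hl⟩ := ih _ hout
      refine ⟨v :: l, by simp [hlen], ?_, ?_⟩
      · simp only [List.mem_cons, forall_eq_or_imp]
        exact ⟨hv, fun x hx => (Finset.mem_filter.1 (hmem x hx)).1⟩
      · exact List.pairwise_cons.2 ⟨fun x hx => (Finset.mem_filter.1 (hmem x hx)).2, hl⟩
    · have hin : 2 ^ t ≤ (A.filter (fun u => G.adj u v)).card := by omega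
      obtain ⟨l, hlen, hmem, hl⟩ := ih _ hin
      refine ⟨l ++ [v], by simp [hlen], ?_, ?_⟩
      · intro x hx
        rcases List.mem_append.1 hx with hx | hx
        · exact (Finset.mem_filter.1 (hmem x hx)).1
        · rwa [List.mem_singleton.1 hx]
      · refine List.pairwise_append.2 ⟨hl, List.pairwise_singleton _ _, fun x hx y hy => ?_⟩
        rw [List.mem_singleton.1 hy]
        exact (Finset.mem_filter.1 (hmem x hx)).2

theorem IsTTCopy.card_eq {G : OrientedGraph V} {t : ℕ} {U : Finset V} (hU : G.IsTTCopy t U) :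
    U.card = t := by
  obtain ⟨f, rfl, -⟩ := hU
  simp

/-- The set defining `oRamsey t` is attained by its infimum. -/
theorem exists_isTTCopy_fin_oRamsey (t : ℕ) (G : OrientedGraph (Fin (oRamsey t)))
    (hG : G.IsTournament) : ∃ U, G.IsTTCopy t U := by
  have hne : {m | ∀ G : OrientedGraph (Fin m), G.IsTournament → ∃ U, G.IsTTCopy t U}.Nonempty := by
    refine ⟨2 ^ t, fun G hG => ?_⟩
    obtain ⟨l, hlen, -, hl⟩ := exists_pairwise_of_two_pow_le_card hG t Finset.univ (by simp)
    exact ⟨_, hlen ▸ IsTTCopy.of_pairwise G hl⟩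
  exact Nat.sInf_mem hne G hG

/-- Every set of at least `oRamsey t` vertices of a tournament contains a copy of `T_t`. -/
theorem exists_isTTCopy_subset {G : OrientedGraph V} (hG : G.IsTournament) (t : ℕ)
    (A : Finset V) (hA : oRamsey t ≤ A.card) : ∃ U ⊆ A, G.IsTTCopy t U := by
  let e : Fin (oRamsey t) ↪ V :=
    (Fin.castLEEmb hA).trans (A.equivFin.symm.toEmbedding.trans (Function.Embedding.subtype _))
  have he : ∀ i, e i ∈ A := fun i => (A.equivFin.symm (Fin.castLE hA i)).2
  obtain ⟨U, f, -, hf⟩ := exists_isTTCopy_fin_oRamsey t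
    ⟨fun i j => G.adj (e i) (e j), fun i j => G.asymm _ _⟩
    (fun i j hij => hG _ _ (e.injective.ne hij))
  refine ⟨Finset.univ.map (f.trans e), ?_, f.trans e, rfl, hf⟩
  intro x hx
  obtain ⟨i, -, rfl⟩ := Finset.mem_map.1 hx
  exact he _

/-- Any `oRamsey t + n` vertices of a tournament carry a fractional `T_t`-tiling of size
`1 + n / t`. In the inductive step one averages the tilings avoiding a single vertex of a fixed
copy of `T_t`, and then adds that copy with weight `1 / t`. -/
theorem exists_isFracTiling_of_card_eq [Fintype V] [DecidableEq V] {G : OrientedGraph V}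
    (hG : G.IsTournament) {t : ℕ} (ht : 0 < t) (n : ℕ) (A : Finset V)
    (hA : A.card = oRamsey t + n) :
    ∃ w : Finset V → ℝ, G.IsFracTiling t w ∧ (∀ X, ¬ X ⊆ A → w X = 0) ∧
      ∑ X : Finset V, w X = 1 + (n : ℝ) / t := by
  have ht' : (0 : ℝ) < t := by exact_mod_cast ht
  obtain ⟨U, hUA, hU⟩ := exists_isTTCopy_subset hG t A (by omega)
  induction n generalizing A U with
  | zero =>
    refine ⟨fun X => if X = U then 1 else 0, ⟨fun X => ?_, fun X hX => ?_, fun v => ?_⟩,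
      fun X hX => ?_, by simp⟩
    · dsimp only
      split_ifs <;> norm_num
    · exact if_neg fun h : X = U => hX (h ▸ hU)
    · rw [Finset.sum_ite_eq']
      split_ifs <;> norm_num
    · exact if_neg fun h : X = U => hX (h ▸ hUA)
  | succ n ih =>
    have key : ∀ v, ∃ w : Finset V → ℝ, v ∈ U → G.IsFracTiling t w ∧
        (∀ X, ¬ X ⊆ A.erase v → w X = 0) ∧ ∑ X : Finset V, w X = 1 + (n : ℝ) / t := by
      intro v
      by_cases hv : v ∈ U
      · have hc : (A.erase v).card = oRamsey t + n := by
          rw [Finset.card_erase_of_mem (hUA hv), hA]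
          omega
        obtain ⟨U', hU'A, hU'⟩ := exists_isTTCopy_subset hG t (A.erase v) (by omega)
        obtain ⟨w, hw⟩ := ih (A.erase v) hc U' hU'A hU'
        exact ⟨w, fun _ => hw⟩
      · exact ⟨0, fun h => absurd h hv⟩
    choose W hW using key
    have hUcard : (U.card : ℝ) = t := by rw [hU.card_eq]
    refine ⟨fun X => (∑ v ∈ U, W v X) / t + if X = U then 1 / (t : ℝ) else 0,
      ⟨fun X => ?_, fun X hX => ?_, fun x => ?_⟩, fun X hX => ?_, ?_⟩
    · have : 0 ≤ ∑ v ∈ U, W v X := Finset.sum_nonneg fun v hv => (hW v hv).1.1 X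
      dsimp only
      split_ifs <;> positivity
    · dsimp only
      rw [Finset.sum_eq_zero fun v hv => (hW v hv).1.2.1 X hX, if_neg fun h : X = U => hX (h ▸ hU)]
      simp
    · rw [Finset.sum_add_distrib, ← Finset.sum_div, Finset.sum_comm, Finset.sum_ite_eq']
      have hle : ∑ v ∈ U, ∑ X with x ∈ X, W v X ≤ ∑ v ∈ U, (1 - if v = x then 1 else 0 : ℝ) := by
        refine Finset.sum_le_sum fun v hv => ?_
        split_ifs with h
        · subst h
          rw [Finset.sum_eq_zero]
          · norm_num
          · intro X hX
            refine (hW v hv).2.1 X fun hsub => ?_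
            exact Finset.notMem_erase v A (hsub (Finset.mem_filter.1 hX).2)
        · simpa using (hW v hv).1.2.2 x
      rw [Finset.sum_sub_distrib, Finset.sum_ite_eq', Finset.sum_const, nsmul_eq_mul, hUcard] at hle
      simp only [Finset.mem_filter, Finset.mem_univ, true_and]
      calc _ ≤ ((t : ℝ) * 1 - if x ∈ U then 1 else 0) / t + (if x ∈ U then 1 / (t : ℝ) else 0) := by
            gcongr
        _ = 1 := by split_ifs <;> field_simp <;> ring
    · dsimp only
      rw [Finset.sum_eq_zero, if_neg fun h : X = U => hX (h ▸ hUA)]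
      · simp
      · exact fun v hv => (hW v hv).2.1 X fun h => hX (h.trans (Finset.erase_subset _ _))
    · rw [Finset.sum_add_distrib, ← Finset.sum_div, Finset.sum_comm, Finset.sum_ite_eq',
        Finset.sum_congr rfl fun v hv => (hW v hv).2.2, Finset.sum_const, nsmul_eq_mul, hUcard]
      simp only [Finset.mem_univ, if_true]
      push_cast
      field_simp
      ring

end OrientedGraph

/-- For `k ≥ 3`, every tournament `S` on `s ≥ r(k-1)` vertices has a fractional
`T_{k-1}`-tiling of size at least `(s - (r(k-1) - k + 1))/(k - 1)`. -/
theorem stmt_5 (k : ℕ) (hk : 3 ≤ k) (s : ℕ) (hs : oRamsey (k - 1) ≤ s)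
    (S : OrientedGraph (Fin s)) (hT : S.IsTournament) :
    ∃ w : Finset (Fin s) → ℝ, S.IsFracTiling (k - 1) w ∧
      ((s : ℝ) - ((oRamsey (k - 1) : ℝ) - (k : ℝ) + 1)) / ((k : ℝ) - 1) ≤
        ∑ U : Finset (Fin s), w U := by
  obtain ⟨n, rfl⟩ := Nat.exists_eq_add_of_le hs
  obtain ⟨w, hw, -, hsum⟩ := OrientedGraph.exists_isFracTiling_of_card_eq hT
    (t := k - 1) (by omega) n Finset.univ (by simp)
  refine ⟨w, hw, ?_⟩
  have hk' : (0 : ℝ) < (k : ℝ) - 1 := by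
    have : (3 : ℝ) ≤ k := by exact_mod_cast hk
    linarith
  rw [hsum, Nat.cast_sub (by omega : 1 ≤ k)]
  push_cast
  apply le_of_eq
  field_simp
  ring
end

section
/- Every tournament on 12 vertices admits a perfect fractional T_4-tiling; that is, trs(4) = 12. -/
open Finset

section Covers

variable {V : Type*} {r : V → V → Prop} {y : V → ℝ} {τ : ℝ}

lemma le_of_common_source (ht : ∀ u v, u ≠ v → r u v ∨ r v u) {s : Finset V}
    (h : ∀ a ∈ s, ∀ b ∈ s, ∀ c ∈ s, r a b → r a c → r b c → τ ≤ y a + y b + y c)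
    {x a b : V} (hx : x ∈ s) (ha : a ∈ s) (hb : b ∈ s) (hab : a ≠ b) (hxa : r x a) (hxb : r x b) :
    τ ≤ y x + y a + y b := by
  rcases ht a b hab with h' | h'
  · exact h x hx a ha b hb hxa hxb h'
  · linarith [h x hx b hb a ha hxb hxa h']

lemma le_of_common_target (ht : ∀ u v, u ≠ v → r u v ∨ r v u) {s : Finset V}
    (h : ∀ a ∈ s, ∀ b ∈ s, ∀ c ∈ s, r a b → r a c → r b c → τ ≤ y a + y b + y c)
    {x a b : V} (hx : x ∈ s) (ha : a ∈ s) (hb : b ∈ s) (hab : a ≠ b) (hax : r a x) (hbx : r b x) :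
    τ ≤ y x + y a + y b := by
  rcases ht a b hab with h' | h'
  · linarith [h a ha b hb x hx h' hax hbx]
  · linarith [h b hb a ha x hx h' hbx hax]

open Classical in
lemma le_card_out_or_le_card_in (ht : ∀ u v, u ≠ v → r u v ∨ r v u) {s : Finset V} {v : V} {k : ℕ}
    (hv : v ∈ s) (hs : 2 * k ≤ s.card) :
    k ≤ ((s.erase v).filter (r v)).card ∨ k ≤ ((s.erase v).filter (r · v)).card := by
  have hsub : s.erase v ⊆ (s.erase v).filter (r v) ∪ (s.erase v).filter (r · v) := fun x hx => by
    have := Finset.mem_erase.1 hx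
    simpa [this] using ht v x this.1.symm
  have h1 := (Finset.card_le_card hsub).trans (Finset.card_union_le _ _)
  rw [Finset.card_erase_of_mem hv] at h1
  omega

/-- Four vertices of a tournament contain a transitive triangle. -/
lemma exists_transitive_triangle (ht : ∀ u v, u ≠ v → r u v ∨ r v u) {s : Finset V}
    (hs : 4 ≤ s.card) :
    ∃ a ∈ s, ∃ b ∈ s, ∃ c ∈ s, r a b ∧ r a c ∧ r b c := by
  classical
  obtain ⟨v, hv⟩ : s.Nonempty := Finset.card_pos.1 (by omega)
  rcases le_card_out_or_le_card_in ht (k := 2) hv hs with h | h <;>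
  · obtain ⟨a, ha, b, hb, hab⟩ := Finset.one_lt_card.1 h
    simp only [Finset.mem_filter, Finset.mem_erase] at ha hb
    rcases ht a b hab with h' | h' <;> grind

lemma ne_of_asymm (hr : ∀ u v, r u v → ¬ r v u) {a b : V} (h : r a b) : a ≠ b := by
  rintro rfl
  exact hr _ _ h h

lemma le_sum_of_four_le_card (hr : ∀ u v, r u v → ¬ r v u)
    (ht : ∀ u v, u ≠ v → r u v ∨ r v u) {s : Finset V} (hy : ∀ v ∈ s, 0 ≤ y v) (hs : 4 ≤ s.card)
    (h : ∀ a ∈ s, ∀ b ∈ s, ∀ c ∈ s, r a b → r a c → r b c → τ ≤ y a + y b + y c) :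
    τ ≤ ∑ v ∈ s, y v := by
  classical
  obtain ⟨a, ha, b, hb, c, hc, hab, hac, hbc⟩ := exists_transitive_triangle ht hs
  have hsub : ({a, b, c} : Finset V) ⊆ s := by grind
  have := Finset.sum_le_sum_of_subset_of_nonneg hsub (fun i hi _ => hy i hi)
  have hab' := ne_of_asymm hr hab
  have hac' := ne_of_asymm hr hac
  have hbc' := ne_of_asymm hr hbc
  rw [Finset.sum_insert (by simp [*]), Finset.sum_pair hbc'] at this
  linarith [h a ha b hb c hc hab hac hbc]

/-- If `v` dominates three of the remaining five vertices, then the six vertices split into two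
transitive triangles; stated here for the corresponding weights. -/
lemma two_mul_le_of_three_out (ht : ∀ u v, u ≠ v → r u v ∨ r v u) {s : Finset V}
    (h : ∀ a ∈ s, ∀ b ∈ s, ∀ c ∈ s, r a b → r a c → r b c → τ ≤ y a + y b + y c)
    {v a b c d e : V} (hv : v ∈ s) (ha : a ∈ s) (hb : b ∈ s) (hc : c ∈ s) (hd : d ∈ s) (he : e ∈ s)
    (hnd : [v, a, b, c, d, e].Nodup) (hva : r v a) (hvb : r v b) (hvc : r v c) :
    2 * τ ≤ y v + y a + y b + y c + y d + y e := by
  simp only [List.nodup_cons, List.mem_cons, List.not_mem_nil, not_or, or_false] at hnd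
  obtain ⟨⟨hva', hvb', hvc', hvd', hve'⟩, ⟨hab, hac, had, hae⟩, ⟨hbc, hbd, hbe⟩, ⟨hcd, hce⟩,
    hde, -⟩ := hnd
  wlog hr : r d e generalizing d e
  · linarith [this he hd hve' hvd' hae had hbe hbd hce hcd (Ne.symm hde)
      ((ht d e hde).resolve_left hr)]
  have hab_v := le_of_common_source ht h hv ha hb hab hva hvb
  have hac_v := le_of_common_source ht h hv ha hc hac hva hvc
  have hbc_v := le_of_common_source ht h hv hb hc hbc hvb hvc
  have key : ∀ z ∈ s, z ≠ d → z ≠ e → τ ≤ y z + y d + y e ∨ r e z ∧ r z d := by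
    intro z hz hzd hze
    rcases ht e z (Ne.symm hze) with h1 | h1
    · rcases ht z d hzd with h2 | h2
      · exact .inr ⟨h1, h2⟩
      · exact .inl (by linarith [le_of_common_source ht h hd hz he hze h2 hr])
    · exact .inl (by linarith [le_of_common_target ht h he hz hd hzd h1 hr])
  rcases key a ha had hae with h1 | ⟨-, h1⟩
  · linarith
  rcases key b hb hbd hbe with h2 | ⟨-, h2⟩
  · linarith
  rcases key c hc hcd hce with h3 | ⟨h3, -⟩
  · linarith
  linarith [le_of_common_target ht h hd ha hb hab h1 h2,
    le_of_common_target ht h hc hv he hve' hvc h3]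

/-- Weighted form of the fact that a tournament on six vertices has a perfect `T_3`-tiling. -/
lemma two_mul_le_sum_of_six_le_card (ht : ∀ u v, u ≠ v → r u v ∨ r v u) {s : Finset V}
    (hy : ∀ v ∈ s, 0 ≤ y v) (hs : 6 ≤ s.card)
    (h : ∀ a ∈ s, ∀ b ∈ s, ∀ c ∈ s, r a b → r a c → r b c → τ ≤ y a + y b + y c) :
    2 * τ ≤ ∑ v ∈ s, y v := by
  classical
  obtain ⟨v, hv⟩ : s.Nonempty := Finset.card_pos.1 (by omega)
  wlog hout : 3 ≤ ((s.erase v).filter (r v)).card generalizing r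
  · refine this (r := flip r) (fun a b hab => ht b a hab.symm) (fun a ha b hb c hc hab hac hbc => ?_)
      ((le_card_out_or_le_card_in ht (k := 3) hv hs).resolve_left hout)
    linarith [h c hc b hb a ha hbc hac hab]
  obtain ⟨t, htsub, htcard⟩ := Finset.exists_subset_card_eq hout
  obtain ⟨a, b, c, hab, hac, hbc, rfl⟩ := Finset.card_eq_three.1 htcard
  have hmem : ∀ x ∈ ({a, b, c} : Finset V), (x ≠ v ∧ x ∈ s) ∧ r v x := fun x hx => by
    simpa using htsub hx
  have ha := hmem a (by simp)
  have hb := hmem b (by simp)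
  have hc := hmem c (by simp)
  have hrest : 1 < (s \ {v, a, b, c}).card := by
    have h1 := Finset.le_card_sdiff {v, a, b, c} s
    have h2 : ({v, a, b, c} : Finset V).card ≤ 4 := Finset.card_le_four
    omega
  obtain ⟨d, hd, e, he, hde⟩ := Finset.one_lt_card.1 hrest
  simp only [Finset.mem_sdiff, Finset.mem_insert, Finset.mem_singleton, not_or] at hd he
  have hnd : [v, a, b, c, d, e].Nodup := by grind
  have hsub : [v, a, b, c, d, e].toFinset ⊆ s := by
    intro x; simp; grind
  have hsum := Finset.sum_le_sum_of_subset_of_nonneg hsub (fun i hi _ => hy i hi)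
  rw [List.sum_toFinset _ hnd] at hsum
  simp only [List.map_cons, List.map_nil, List.sum_cons, List.sum_nil] at hsum
  linarith [two_mul_le_of_three_out ht h hv ha.1.2 hb.1.2 hc.1.2 hd.1 he.1 hnd ha.2 hb.2 hc.2]

/-- Weighted form of the fact that a tournament on nine vertices has a perfect `T_3`-tiling. -/
lemma three_mul_le_sum_of_nine_le_card (hr : ∀ u v, r u v → ¬ r v u)
    (ht : ∀ u v, u ≠ v → r u v ∨ r v u) {s : Finset V} (hy : ∀ v ∈ s, 0 ≤ y v) (hs : 9 ≤ s.card)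
    (h : ∀ a ∈ s, ∀ b ∈ s, ∀ c ∈ s, r a b → r a c → r b c → τ ≤ y a + y b + y c) :
    3 * τ ≤ ∑ v ∈ s, y v := by
  classical
  obtain ⟨a, ha, b, hb, c, hc, hab, hac, hbc⟩ :=
    exists_transitive_triangle ht (show 4 ≤ s.card by omega)
  have hsub : ({a, b, c} : Finset V) ⊆ s := by grind
  have hcard : 6 ≤ (s \ {a, b, c}).card := by
    have h1 := Finset.le_card_sdiff {a, b, c} s
    have h2 : ({a, b, c} : Finset V).card ≤ 3 := Finset.card_le_three
    omega
  have h6 := two_mul_le_sum_of_six_le_card (τ := τ) ht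
    (fun v hv => hy v (Finset.mem_sdiff.1 hv).1) hcard (by grind)
  have hsum := Finset.sum_sdiff (f := y) hsub
  rw [Finset.sum_insert (by simp [ne_of_asymm hr hab, ne_of_asymm hr hac]),
    Finset.sum_pair (ne_of_asymm hr hbc)] at hsum
  linarith [h a ha b hb c hc hab hac hbc]

/-- The remaining case of `three_mul_le_sum_of_apex`: exactly eight out-neighbours. -/
lemma three_mul_le_sum_of_eight_out (ht : ∀ u v, u ≠ v → r u v ∨ r v u) {N M : Finset V}
    (hyN : ∀ v ∈ N, 0 ≤ y v) (hyM : ∀ v ∈ M, 0 ≤ y v) {v : V} (hv : y v = 0)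
    (h4 : ∀ a b c d, r a b → r a c → r a d → r b c → r b d → r c d → τ ≤ y a + y b + y c + y d)
    (hN : ∀ x ∈ N, r v x) (hM : ∀ x ∈ M, r x v) (hMN : Disjoint M N)
    (hcN : 8 ≤ N.card) (hcM : 2 ≤ M.card) :
    3 * τ ≤ ∑ x ∈ N, y x + ∑ x ∈ M, y x := by
  classical
  have hT : ∀ a ∈ N, ∀ b ∈ N, ∀ c ∈ N, r a b → r a c → r b c → τ ≤ y a + y b + y c := by
    intro a ha b hb c hc hab hac hbc
    linarith [h4 v a b c (hN a ha) (hN b hb) (hN c hc) hab hac hbc]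
  have hpair : ∀ n ∈ N, ∀ n' ∈ N, n ≠ n' → 2 * τ + y n + y n' ≤ ∑ x ∈ N, y x := by
    intro n hn n' hn' hne
    have hsub : ({n, n'} : Finset V) ⊆ N := by grind
    have hcard : 6 ≤ (N \ {n, n'}).card := by
      have h1 := Finset.le_card_sdiff {n, n'} N
      have h2 : ({n, n'} : Finset V).card ≤ 2 := Finset.card_le_two
      omega
    have h6 := two_mul_le_sum_of_six_le_card (τ := τ) ht
      (fun v hv => hyN v (Finset.mem_sdiff.1 hv).1) hcard (by grind)
    have hsum := Finset.sum_sdiff (f := y) hsub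
    rw [Finset.sum_pair hne] at hsum
    linarith
  by_cases hbig : ∃ c ∈ M, 1 < (N.filter (r c)).card
  · obtain ⟨c, hc, hcard⟩ := hbig
    obtain ⟨n, hn, n', hn', hne⟩ := Finset.one_lt_card.1 hcard
    simp only [Finset.mem_filter] at hn hn'
    have hle : τ ≤ y c + y n + y n' := by
      rcases ht n n' hne with h | h
      · linarith [h4 c v n n' (hM c hc) hn.2 hn'.2 (hN n hn.1) (hN n' hn'.1) h]
      · linarith [h4 c v n' n (hM c hc) hn'.2 hn.2 (hN n' hn'.1) (hN n hn.1) h]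
    linarith [hpair n hn.1 n' hn'.1 hne, Finset.single_le_sum hyM hc]
  · push Not at hbig
    obtain ⟨c, hc, c', hc', hcc, hrc⟩ : ∃ c ∈ M, ∃ c' ∈ M, c ≠ c' ∧ r c c' := by
      obtain ⟨c, hc, c', hc', hne⟩ := Finset.one_lt_card.1 hcM
      rcases ht c c' hne with h | h
      · exact ⟨c, hc, c', hc', hne, h⟩
      · exact ⟨c', hc', c, hc, hne.symm, h⟩
    have hcard : 1 < (N \ (N.filter (r c) ∪ N.filter (r c'))).card := by
      have h1 := Finset.le_card_sdiff (N.filter (r c) ∪ N.filter (r c')) N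
      have h2 := Finset.card_union_le (N.filter (r c)) (N.filter (r c'))
      have h3 := hbig c hc
      have h5 := hbig c' hc'
      omega
    obtain ⟨n, hn, n', hn', hne⟩ := Finset.one_lt_card.1 hcard
    have hdom : ∀ x ∈ N \ (N.filter (r c) ∪ N.filter (r c')), x ∈ N ∧ r x c ∧ r x c' := by
      intro x hx
      simp only [Finset.mem_sdiff, Finset.mem_union, Finset.mem_filter, not_or, not_and] at hx
      have hxM : x ∉ M := fun hxM => Finset.disjoint_left.1 hMN hxM hx.1
      exact ⟨hx.1, (ht x c (by grind)).resolve_right (hx.2.1 hx.1),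
        (ht x c' (by grind)).resolve_right (hx.2.2 hx.1)⟩
    obtain ⟨hnN, hnc, hnc'⟩ := hdom n hn
    obtain ⟨hnN', hn'c, hn'c'⟩ := hdom n' hn'
    have hle : τ ≤ y n + y n' + y c + y c' := by
      rcases ht n n' hne with h | h
      · linarith [h4 n n' c c' h hnc hnc' hn'c hn'c' hrc]
      · linarith [h4 n' n c c' h hn'c hn'c' hnc hnc' hrc]
    have hsum := Finset.sum_le_sum_of_subset_of_nonneg (show ({c, c'} : Finset V) ⊆ M by grind)
      (fun i hi _ => hyM i hi)
    rw [Finset.sum_pair hcc] at hsum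
    linarith [hpair n hnN n' hnN' hne]

/-- A nonnegative weighting of a tournament on twelve vertices that vanishes somewhere and gives
every `T_4` weight at least `τ` has total weight at least `3 * τ`. -/
lemma three_mul_le_sum_of_apex [Fintype V] (hV : Fintype.card V = 12)
    (hr : ∀ u v, r u v → ¬ r v u) (ht : ∀ u v, u ≠ v → r u v ∨ r v u) (hy : ∀ v, 0 ≤ y v)
    {v : V} (hv : y v = 0)
    (h4 : ∀ a b c d, r a b → r a c → r a d → r b c → r b d → r c d → τ ≤ y a + y b + y c + y d) :
    3 * τ ≤ ∑ x, y x := by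
  classical
  wlog hout : 6 ≤ ((Finset.univ.erase v).filter (r v)).card generalizing r
  · refine this (r := flip r) (fun a b => hr b a) (fun a b hab => ht b a hab.symm)
      (fun a b c d hab hac had hbc hbd hcd => ?_)
      ((le_card_out_or_le_card_in ht (k := 6) (Finset.mem_univ v) (by simp [hV])).resolve_left hout)
    linarith [h4 d c b a hcd hbd had hbc hac hab]
  set N := (Finset.univ.erase v).filter (r v) with hNdef
  set M := (Finset.univ.erase v).filter (fun x => ¬ r v x) with hMdef
  have hN : ∀ x ∈ N, r v x := fun x hx => (Finset.mem_filter.1 hx).2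
  have hM : ∀ x ∈ M, r x v := fun x hx => by
    simp only [hMdef, Finset.mem_filter, Finset.mem_erase] at hx
    exact (ht x v hx.1.1).resolve_right hx.2
  have hsum : ∑ x, y x = ∑ x ∈ N, y x + ∑ x ∈ M, y x := by
    rw [Finset.sum_filter_add_sum_filter_not, ← Finset.add_sum_erase _ _ (Finset.mem_univ v), hv,
      zero_add]
  have hcard : N.card + M.card = 11 := by
    rw [Finset.card_filter_add_card_filter_not, Finset.card_erase_of_mem (Finset.mem_univ v),
      Finset.card_univ, hV]
  have hTN : ∀ a ∈ N, ∀ b ∈ N, ∀ c ∈ N, r a b → r a c → r b c → τ ≤ y a + y b + y c := by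
    intro a ha b hb c hc hab hac hbc
    linarith [h4 v a b c (hN a ha) (hN b hb) (hN c hc) hab hac hbc]
  have hTM : ∀ a ∈ M, ∀ b ∈ M, ∀ c ∈ M, r a b → r a c → r b c → τ ≤ y a + y b + y c := by
    intro a ha b hb c hc hab hac hbc
    linarith [h4 a b c v hab hac (hM a ha) hbc (hM b hb) (hM c hc)]
  rw [hsum]
  rcases le_or_gt 9 N.card with h9 | h9
  · linarith [three_mul_le_sum_of_nine_le_card hr ht (fun x _ => hy x) h9 hTN,
      Finset.sum_nonneg (s := M) (fun x _ => hy x)]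
  rcases le_or_gt 8 N.card with h8 | h8
  · exact three_mul_le_sum_of_eight_out ht (fun x _ => hy x) (fun x _ => hy x) hv h4 hN hM
      (Finset.disjoint_filter_filter_not _ _ _).symm h8 (by omega)
  · linarith [two_mul_le_sum_of_six_le_card ht (fun x _ => hy x) hout hTN,
      le_sum_of_four_le_card hr ht (fun x _ => hy x) (show 4 ≤ M.card by omega) hTM]

end Covers

namespace OrientedGraph

variable {V : Type*} {G : OrientedGraph V}

lemma isTTCopy_four [DecidableEq V] {a b c d : V} (hab : G.adj a b) (hac : G.adj a c)
    (had : G.adj a d) (hbc : G.adj b c) (hbd : G.adj b d) (hcd : G.adj c d) :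
    G.IsTTCopy 4 {a, b, c, d} := by
  have hadj : ∀ i j : Fin 4, i < j → G.adj (![a, b, c, d] i) (![a, b, c, d] j) := by
    intro i j hij
    fin_cases i <;> fin_cases j <;> simp_all
  refine ⟨⟨![a, b, c, d], fun i j hij => ?_⟩, ?_, hadj⟩
  · rcases lt_trichotomy i j with h | h | h
    · exact absurd hij (ne_of_asymm G.asymm (hadj i j h))
    · exact h
    · exact absurd hij.symm (ne_of_asymm G.asymm (hadj j i h))
  · ext x
    simp only [Finset.mem_map, Finset.mem_univ, true_and]
    change (∃ i, ![a, b, c, d] i = x) ↔ _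
    simp [Fin.exists_fin_succ, eq_comm]

variable [Fintype V] [DecidableEq V]

/-- The vertex loads of a weight function on vertex sets. -/
def load : (Finset V → ℝ) →ₗ[ℝ] V → ℝ where
  toFun w v := ∑ U ∈ Finset.univ.filter (fun U => v ∈ U), w U
  map_add' w w' := by ext; simp [Finset.sum_add_distrib]
  map_smul' c w := by ext; simp [Finset.mul_sum]

/-- Linear programming duality: if every real vertex weighting has a copy of `T_k` of at most average
weight, then there is a perfect fractional tiling. -/
lemma hasPerfectFracTiling_of_forall_weight [Nonempty V] {k : ℕ} (hk : 0 < k)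
    (h : ∀ (z : V → ℝ) (τ : ℝ), (∀ U, G.IsTTCopy k U → τ < ∑ v ∈ U, z v) →
      (Fintype.card V : ℝ) / k * τ ≤ ∑ v, z v) :
    G.HasPerfectFracTiling k := by
  have hn : (0 : ℝ) < Fintype.card V := by exact_mod_cast Fintype.card_pos
  have hk' : (0 : ℝ) < k := by exact_mod_cast hk
  let P : Set (Finset V → ℝ) := stdSimplex ℝ (Finset V) ∩ {w | ∀ U, ¬ G.IsTTCopy k U → w U = 0}
  have hPcompact : IsCompact P := by
    refine (isCompact_stdSimplex ℝ _).inter_right ?_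
    simp only [Set.ofPred_forall]
    exact isClosed_iInter fun U => isClosed_iInter fun _ =>
      isClosed_eq (continuous_apply U) continuous_const
  have hPconvex : Convex ℝ P := by
    refine (convex_stdSimplex ℝ _).inter fun w hw w' hw' a b _ _ _ U hU => ?_
    simp [hw U hU, hw' U hU]
  have hmem : (fun _ => (k : ℝ) / Fintype.card V) ∈ load '' P := by
    by_contra hnot
    obtain ⟨f, τ, hfτ, hf⟩ := geometric_hahn_banach_point_closed
      (hPconvex.linear_image load)
      (hPcompact.image (LinearMap.continuous_of_finiteDimensional load)).isClosed hnot
    have hfsum : ∀ x : V → ℝ, f x = ∑ v, x v * f (Pi.single v 1) := fun x => by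
      conv_lhs => rw [← Finset.univ_sum_single x, map_sum]
      refine Finset.sum_congr rfl fun v _ => ?_
      rw [← smul_eq_mul, ← map_smul, ← Pi.single_smul', smul_eq_mul, mul_one]
    have hle := h (fun v => f (Pi.single v 1)) τ (fun U hU => by
      have := hf _ ⟨Pi.single U 1, ⟨single_mem_stdSimplex ℝ U, fun U' hU' =>
        Pi.single_eq_of_ne (by rintro rfl; exact hU' hU) 1⟩, rfl⟩
      have hload : load (Pi.single U 1) = fun v => if v ∈ U then (1 : ℝ) else 0 := by
        ext v
        simp [load, Pi.single_apply]
      rw [hfsum, hload] at this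
      simpa using this)
    rw [hfsum, ← Finset.mul_sum] at hfτ
    rw [div_mul_eq_mul_div, div_le_iff₀ hk'] at hle
    rw [div_mul_eq_mul_div, div_lt_iff₀ hn] at hfτ
    linarith
  obtain ⟨w, ⟨⟨hw0, hw1⟩, hwT⟩, hw⟩ := hmem
  refine ⟨fun U => Fintype.card V / k * w U, ⟨fun U => mul_nonneg (by positivity) (hw0 U),
    fun U hU => by simp [hwT U hU], fun v => ?_⟩, ?_⟩
  · have := congrFun hw v
    simp only [load, LinearMap.coe_mk, AddHom.coe_mk] at this
    rw [← Finset.mul_sum, this]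
    field_simp
    exact le_rfl
  · rw [← Finset.mul_sum, hw1, mul_one]

lemma hasPerfectFracTiling_four_of_card_eq_twelve (hV : Fintype.card V = 12)
    (hG : G.IsTournament) : G.HasPerfectFracTiling 4 := by
  have : Nonempty V := Fintype.card_pos_iff.1 (by omega)
  refine hasPerfectFracTiling_of_forall_weight (by norm_num) fun z τ hz => ?_
  obtain ⟨v, hv⟩ := Finite.exists_min z
  have := three_mul_le_sum_of_apex (y := fun x => z x - z v) (τ := τ - 4 * z v) hV G.asymm hG
    (fun x => sub_nonneg.2 (hv x)) (sub_self (z v))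
    (fun a b c d hab hac had hbc hbd hcd => by
      have hU := hz _ (isTTCopy_four hab hac had hbc hbd hcd)
      have hne := fun {a b} => ne_of_asymm (a := a) (b := b) G.asymm
      rw [Finset.sum_insert (by simp [hne hab, hne hac, hne had]),
        Finset.sum_insert (by simp [hne hbc, hne hbd]), Finset.sum_pair (hne hcd)] at hU
      linarith)
  rw [Finset.sum_sub_distrib, Finset.sum_const, Finset.card_univ, hV] at this
  rw [hV]
  norm_num at this ⊢
  linarith

/-- Weak duality: the total weight of a fractional tiling is at most that of any fractional cover. -/
lemma IsFracTiling.sum_le {k : ℕ} {w : Finset V → ℝ} (hw : G.IsFracTiling k w) {y : V → ℝ}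
    (hy : ∀ v, 0 ≤ y v) (hcover : ∀ U, G.IsTTCopy k U → 1 ≤ ∑ v ∈ U, y v) :
    ∑ U, w U ≤ ∑ v, y v := by
  calc ∑ U, w U ≤ ∑ U, w U * ∑ v ∈ U, y v := by
        refine Finset.sum_le_sum fun U _ => ?_
        by_cases hU : G.IsTTCopy k U
        · exact le_mul_of_one_le_right (hw.1 U) (hcover U hU)
        · simp [hw.2.1 U hU]
    _ = ∑ v, y v * ∑ U ∈ Finset.univ.filter (fun U => v ∈ U), w U := by
        simp only [Finset.mul_sum]
        rw [Finset.sum_comm' (t' := Finset.univ) (s' := fun v => Finset.univ.filter (v ∈ ·))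
          (by simp)]
        exact Finset.sum_congr rfl fun v _ => Finset.sum_congr rfl fun U _ => mul_comm _ _
    _ ≤ ∑ v, y v := Finset.sum_le_sum fun v _ => mul_le_of_le_one_right (hy v) (hw.2.2 v)

end OrientedGraph

/-- Adjacency in the Paley tournament on seven vertices. -/
def paleyAdj (i j : ZMod 7) : Prop := j - i = 1 ∨ j - i = 2 ∨ j - i = 4

instance : DecidableRel paleyAdj := fun _ _ => inferInstanceAs (Decidable (_ ∨ _))

lemma paleyAdj_asymm : ∀ i j, paleyAdj i j → ¬ paleyAdj j i := by decide

lemma paleyAdj_total : ∀ i j, i ≠ j → paleyAdj i j ∨ paleyAdj j i := by decide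

lemma paleyAdj_no_transitive_four : ∀ a b, paleyAdj a b → ∀ c, paleyAdj a c → paleyAdj b c →
    ∀ d, paleyAdj a d → paleyAdj b d → ¬ paleyAdj c d := by decide

/-- The Paley tournament on seven vertices with one vertex replaced by a transitive tournament on
`n - 6` vertices. -/
def paleyBlowup (n : ℕ) : OrientedGraph (Fin n) where
  adj i j := paleyAdj (min i.val 6 : ℕ) (min j.val 6 : ℕ) ∨ 6 ≤ i.val ∧ i < j
  asymm i j h h' := by
    have hself : ∀ i, ¬ paleyAdj i i := by decide
    rcases h with h | ⟨h1, h2⟩ <;> rcases h' with h' | ⟨h3, h4⟩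
    · exact paleyAdj_asymm _ _ h h'
    · rw [min_eq_right (h3.trans h4.le), min_eq_right h3] at h
      exact hself _ h
    · rw [min_eq_right (h1.trans h2.le), min_eq_right h1] at h'
      exact hself _ h'
    · exact lt_asymm h2 h4

lemma natCast_min_six_injOn {a b : ℕ} (h : ((min a 6 : ℕ) : ZMod 7) = (min b 6 : ℕ)) :
    min a 6 = min b 6 := by
  have := (ZMod.natCast_eq_natCast_iff' _ _ _).1 h
  omega

lemma paleyBlowup_isTournament (n : ℕ) : (paleyBlowup n).IsTournament := by
  intro u v huv
  by_cases h : ((min u.val 6 : ℕ) : ZMod 7) = (min v.val 6 : ℕ)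
  · have := natCast_min_six_injOn h
    rcases lt_or_gt_of_ne huv with h' | h'
    · exact .inl (.inr ⟨by omega, h'⟩)
    · exact .inr (.inr ⟨by omega, h'⟩)
  · exact (paleyAdj_total _ _ h).imp .inl .inl

lemma one_lt_card_filter_of_isTTCopy {n : ℕ} {U : Finset (Fin n)}
    (hU : (paleyBlowup n).IsTTCopy 4 U) : 1 < (U.filter (fun v => 6 ≤ v.val)).card := by
  obtain ⟨f, rfl, hf⟩ := hU
  by_contra! hcard
  have huniq := Finset.card_le_one.1 hcard
  have hpaley : ∀ i j : Fin 4, i < j →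
      paleyAdj (min (f i).val 6 : ℕ) (min (f j).val 6 : ℕ) := by
    intro i j hij
    refine (hf i j hij).resolve_right fun ⟨h1, h2⟩ => ?_
    exact h2.ne (huniq _ (by simp [h1]) _ (by simp [h1.trans h2.le]))
  exact paleyAdj_no_transitive_four _ _ (hpaley 0 1 (by decide)) _ (hpaley 0 2 (by decide))
    (hpaley 1 2 (by decide)) _ (hpaley 0 3 (by decide)) (hpaley 1 3 (by decide))
    (hpaley 2 3 (by decide))

lemma paleyBlowup_not_hasPerfectFracTiling {n : ℕ} (hn : 0 < n) (hn' : n < 12) :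
    ¬ (paleyBlowup n).HasPerfectFracTiling 4 := by
  rintro ⟨w, hw, hsum⟩
  have hle := hw.sum_le (y := fun v => if 6 ≤ v.val then 1 / 2 else 0)
    (fun v => by split_ifs <;> norm_num) (fun U hU => by
      have h2 : (2 : ℝ) ≤ (U.filter (fun v => 6 ≤ v.val)).card := by
        exact_mod_cast one_lt_card_filter_of_isTTCopy hU
      rw [← Finset.sum_filter, Finset.sum_const, nsmul_eq_mul]
      linarith)
  rw [hsum, Fintype.card_fin, Fin.sum_univ_eq_sum_range (fun i => if 6 ≤ i then (1 / 2 : ℝ) else 0)]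
    at hle
  interval_cases n <;> norm_num [Finset.sum_range_succ] at hle

/-- Every tournament on `12` vertices has a perfect fractional `T_4`-tiling;
that is, `trs(4) = 12`. -/
theorem stmt_10 :
    (∀ G : OrientedGraph (Fin 12), G.IsTournament → G.HasPerfectFracTiling 4) ∧
      trs 4 = 12 := by
  have h12 : ∀ G : OrientedGraph (Fin 12), G.IsTournament → G.HasPerfectFracTiling 4 :=
    fun _ hG => OrientedGraph.hasPerfectFracTiling_four_of_card_eq_twelve (Fintype.card_fin 12) hG
  refine ⟨h12, le_antisymm (Nat.sInf_le ⟨by norm_num, h12⟩) ?_⟩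
  refine le_csInf ⟨12, by norm_num, h12⟩ fun n ⟨hn, h⟩ => ?_
  by_contra! hlt
  exact paleyBlowup_not_hasPerfectFracTiling hn hlt (h _ (paleyBlowup_isTournament n))
end

section
/- Let T be a tournament on 12 vertices, v a vertex of T with in-degree 3 and out-degree 8, and suppose every vertex in N⁻(v) has at most one out-neighbor in N⁺(v). Then T has a perfect T_4-tiling (three vertex-disjoint copies of the transitive tournament T_4 covering all 12 vertices). -/
open Finset

namespace OrientedGraph

variable {V : Type*} {G : OrientedGraph V}

lemma not_adj_self (G : OrientedGraph V) (v : V) : ¬ G.adj v v := fun h => G.asymm v v h h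

lemma isTTCopy_singleton (v : V) : G.IsTTCopy 1 {v} := by
  refine ⟨⟨fun _ => v, fun i j _ => Subsingleton.elim i j⟩, by simp; rfl, ?_⟩
  intro i j hij
  omega

variable [DecidableEq V]

lemma IsTTCopy.insert_source {k : ℕ} {U : Finset V} (hU : G.IsTTCopy k U) {v : V}
    (hv : ∀ u ∈ U, G.adj v u) : G.IsTTCopy (k + 1) (insert v U) := by
  obtain ⟨f, rfl, hf⟩ := hU
  have hv' : ∀ i, G.adj v (f i) := fun i => hv _ (by simp)
  have hinj : Function.Injective (Fin.cons v f : Fin (k + 1) → V) := by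
    rw [Fin.cons_injective_iff]
    refine ⟨?_, f.injective⟩
    rintro ⟨i, hi⟩
    exact G.not_adj_self v (by simpa [hi] using hv' i)
  refine ⟨⟨_, hinj⟩, ?_, ?_⟩
  · ext w
    simp [Fin.exists_fin_succ, eq_comm]
  · intro i j
    refine Fin.cases ?_ (fun i => ?_) i <;> refine Fin.cases ?_ (fun j => ?_) j
    · simp
    · simpa using hv' j
    · simp
    · simpa using hf i j

lemma IsTTCopy.insert_sink {k : ℕ} {U : Finset V} (hU : G.IsTTCopy k U) {v : V}
    (hv : ∀ u ∈ U, G.adj u v) : G.IsTTCopy (k + 1) (insert v U) := by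
  obtain ⟨f, rfl, hf⟩ := hU
  have hv' : ∀ i, G.adj (f i) v := fun i => hv _ (by simp)
  have hinj : Function.Injective (Fin.snoc f v : Fin (k + 1) → V) := by
    rw [Fin.snoc_injective_iff]
    refine ⟨f.injective, ?_⟩
    rintro ⟨i, hi⟩
    exact G.not_adj_self v (by simpa [hi] using hv' i)
  refine ⟨⟨_, hinj⟩, ?_, ?_⟩
  · ext w
    simp [Fin.exists_fin_succ', eq_comm, or_comm]
  · intro i j
    refine Fin.lastCases ?_ (fun i => ?_) i <;> refine Fin.lastCases ?_ (fun j => ?_) j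
    · simp
    · intro h
      exact absurd h (Fin.castSucc_lt_last j).not_gt
    · simpa using hv' i
    · simpa using hf i j

lemma IsTournament.isTTCopy_pair (hT : G.IsTournament) {a b : V} (hab : a ≠ b) :
    G.IsTTCopy 2 {a, b} := by
  rcases hT a b hab with h | h
  · exact (isTTCopy_singleton b).insert_source (by simpa using h)
  · exact (isTTCopy_singleton b).insert_sink (by simpa using h)

lemma IsTournament.cyclic_of_not_isTTCopy (hT : G.IsTournament) {a b c : V} (hac : a ≠ c)
    (hbc : b ≠ c) (hab : G.adj a b) (h : ¬ G.IsTTCopy 3 {c, a, b}) :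
    G.adj b c ∧ G.adj c a := by
  have hne : a ≠ b := by
    rintro rfl
    exact G.not_adj_self a hab
  have hpair := hT.isTTCopy_pair hne
  rcases hT a c hac with h₁ | h₁ <;> rcases hT b c hbc with h₂ | h₂
  · exact absurd (hpair.insert_sink (by simp [h₁, h₂])) h
  · refine absurd ((hT.isTTCopy_pair hbc).insert_source (v := a) (by simp [h₁, hab])) ?_
    rwa [show ({a, b, c} : Finset V) = {c, a, b} by ext; simp; tauto]
  · exact ⟨h₂, h₁⟩
  · exact absurd (hpair.insert_source (by simp [h₁, h₂])) h

open Classical in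
lemma IsTournament.exists_three_le_card_outNeighbors (hT : G.IsTournament) {S : Finset V}
    (hS : #S = 6) : ∃ x ∈ S, 3 ≤ #{y ∈ S | G.adj x y} := by
  by_contra! hlt
  have hin : ∀ x ∈ S, 3 ≤ #{y ∈ S | G.adj y x} := by
    intro x hx
    have hsub : S.erase x ⊆ {y ∈ S | G.adj x y} ∪ {y ∈ S | G.adj y x} := by
      intro y hy
      rw [mem_erase] at hy
      simpa [hy.2] using hT x y hy.1.symm
    have h₁ := (card_le_card hsub).trans (card_union_le _ _)
    rw [card_erase_of_mem hx, hS] at h₁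
    have := hlt x hx
    omega
  have hcount := sum_card_bipartiteAbove_eq_sum_card_bipartiteBelow (s := S) (t := S) G.adj
  have hle : ∑ x ∈ S, #(S.bipartiteAbove G.adj x) ≤ ∑ _x ∈ S, 2 :=
    sum_le_sum fun x hx => Nat.le_of_lt_succ (hlt x hx)
  have hge : ∑ _x ∈ S, 3 ≤ ∑ x ∈ S, #(S.bipartiteBelow G.adj x) :=
    sum_le_sum fun x hx => hin x hx
  simp only [sum_const, hS, smul_eq_mul] at hle hge
  omega

lemma IsTournament.exists_isTTCopy_three_sdiff (hT : G.IsTournament) {S : Finset V}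
    (hS : #S = 6) : ∃ X ⊆ S, G.IsTTCopy 3 X ∧ G.IsTTCopy 3 (S \ X) := by
  classical
  obtain ⟨x, hx, hout⟩ := hT.exists_three_le_card_outNeighbors hS
  obtain ⟨O, hO, hO3⟩ := exists_subset_card_eq hout
  have hxO : ∀ y ∈ O, G.adj x y := fun y hy => (mem_filter.mp (hO hy)).2
  have hOS : O ⊆ S := hO.trans (filter_subset _ _)
  have hxn : x ∉ O := fun h => G.not_adj_self x (hxO x h)
  have hrest : #(S \ insert x O) = 2 := by
    rw [card_sdiff_of_subset (insert_subset hx hOS), card_insert_of_notMem hxn, hS, hO3]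
  obtain ⟨d, e, hde, hade⟩ :
      ∃ d e, G.adj d e ∧ S \ insert x O = {d, e} := by
    obtain ⟨d, e, hne, h⟩ := card_eq_two.mp hrest
    rcases hT d e hne with hd | hd
    · exact ⟨d, e, hd, h⟩
    · exact ⟨e, d, hd, h.trans (pair_comm d e)⟩
  obtain ⟨a, b, c, hab, hac, hbc, rfl⟩ := card_eq_three.mp hO3
  have hne : d ≠ e := by
    rintro rfl
    exact G.not_adj_self d hde
  have hd : d ∈ S \ insert x {a, b, c} := by simp [hade]
  have he : e ∈ S \ insert x {a, b, c} := by simp [hade]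
  have hSeq : S = {x, a, b, c, d, e} := by
    rw [← sdiff_union_of_subset (insert_subset hx hOS), hade]
    ext; simp; tauto
  simp only [mem_sdiff, mem_insert, mem_singleton, not_or] at hd he hxn
  obtain ⟨-, hdx, hda, hdb, hdc⟩ := hd
  obtain ⟨-, hex, hea, heb, hec⟩ := he
  obtain ⟨hxa, hxb, hxc⟩ := hxn
  have hxa' : G.adj x a := hxO a (by simp)
  have hxb' : G.adj x b := hxO b (by simp)
  have hxc' : G.adj x c := hxO c (by simp)
  clear hO hxO hOS hout hrest hade hO3
  subst hSeq
  by_cases ha : G.IsTTCopy 3 {a, d, e}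
  · refine ⟨{a, d, e}, by simp [insert_subset_iff], ha, ?_⟩
    rw [show ({x, a, b, c, d, e} : Finset V) \ {a, d, e} = {x, b, c} by grind]
    exact (hT.isTTCopy_pair hbc).insert_source (by simp [hxb', hxc'])
  by_cases hb : G.IsTTCopy 3 {b, d, e}
  · refine ⟨{b, d, e}, by simp [insert_subset_iff], hb, ?_⟩
    rw [show ({x, a, b, c, d, e} : Finset V) \ {b, d, e} = {x, a, c} by grind]
    exact (hT.isTTCopy_pair hac).insert_source (by simp [hxa', hxc'])
  by_cases hc : G.IsTTCopy 3 {c, d, e}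
  · refine ⟨{c, d, e}, by simp [insert_subset_iff], hc, ?_⟩
    rw [show ({x, a, b, c, d, e} : Finset V) \ {c, d, e} = {x, a, b} by grind]
    exact (hT.isTTCopy_pair hab).insert_source (by simp [hxa', hxb'])
  have ha' := hT.cyclic_of_not_isTTCopy hda hea hde ha
  have hb' := hT.cyclic_of_not_isTTCopy hdb heb hde hb
  have hc' := hT.cyclic_of_not_isTTCopy hdc hec hde hc
  refine ⟨{a, x, e}, by simp [insert_subset_iff], ?_, ?_⟩
  · exact (hT.isTTCopy_pair (Ne.symm hex)).insert_sink (by simp [hxa', ha'.1])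
  · rw [show ({x, a, b, c, d, e} : Finset V) \ {a, x, e} = {d, b, c} by grind]
    exact (hT.isTTCopy_pair hbc).insert_sink (by simp [hb'.2, hc'.2])

lemma IsTournament.isTTCopy_union (hT : G.IsTournament) {X Y : Finset V} (hX : #X = 2)
    (hY : #Y = 2) (hXY : ∀ x ∈ X, ∀ y ∈ Y, G.adj x y) : G.IsTTCopy 4 (X ∪ Y) := by
  obtain ⟨p, q, hpq, hX'⟩ : ∃ p q, G.adj p q ∧ X = {p, q} := by
    obtain ⟨p, q, hne, h⟩ := card_eq_two.mp hX
    rcases hT p q hne with hp | hp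
    · exact ⟨p, q, hp, h⟩
    · exact ⟨q, p, hp, h.trans (pair_comm p q)⟩
  obtain ⟨r, s, hrs, hY'⟩ := card_eq_two.mp hY
  subst hX' hY'
  simp only [mem_insert, mem_singleton, forall_eq_or_imp, forall_eq] at hXY
  rw [show ({p, q} ∪ {r, s} : Finset V) = insert p (insert q {r, s}) by ext; simp; tauto]
  refine ((hT.isTTCopy_pair hrs).insert_source ?_).insert_source ?_
  · simp [hXY]
  · simp [hXY, hpq]

end OrientedGraph

/-- If `T` is a tournament on `12` vertices with a vertex `v` of in-degree `3` and
out-degree `8` such that every vertex of `N⁻(v)` has at most one out-neighbour in `N⁺(v)`,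
then `T` has a perfect `T_4`-tiling. -/
theorem stmt_11 {V : Type*} [Fintype V] [DecidableEq V] (G : OrientedGraph V)
    (hT : G.IsTournament) (hcard : Fintype.card V = 12) (v : V)
    (hin : Nat.card {u : V // G.adj u v} = 3)
    (hout : Nat.card {u : V // G.adj v u} = 8)
    (h1 : ∀ u : V, G.adj u v → Nat.card {w : V // G.adj u w ∧ G.adj v w} ≤ 1) :
    G.HasPerfectTiling 4 := by
  classical
  have hcount : ∀ p : V → Prop, Nat.card {u : V // p u} = #{u | p u} := fun p => by
    rw [Nat.card_eq_fintype_card, Fintype.card_subtype]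
  rw [hcount] at hin hout
  set A : Finset V := {u | G.adj u v} with hA
  set B : Finset V := {u | G.adj v u} with hB
  have hbad : ∀ a ∈ A, #{w ∈ B | G.adj a w} ≤ 1 := by
    intro a ha
    have := h1 a (by simpa [hA] using ha)
    rw [hcount] at this
    convert this using 2
    ext w
    simp [hB, and_comm]
  have hdom : ∀ a ∈ A, ∀ b ∈ B, ¬ G.adj a b → G.adj b a := by
    intro a ha b hb hn
    refine (hT a b ?_).resolve_left hn
    rintro rfl
    exact G.asymm a v (by simpa [hA] using ha) (by simpa [hB] using hb)
  have hsmall : #(A.biUnion fun a => {w ∈ B | G.adj a w}) ≤ 3 :=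
    (card_biUnion_le_card_mul A _ 1 hbad).trans (by omega)
  obtain ⟨Z, hZ, hZ2⟩ : ∃ Z ⊆ B \ A.biUnion fun a => {w ∈ B | G.adj a w}, #Z = 2 := by
    refine exists_subset_card_eq ?_
    have := le_card_sdiff (A.biUnion fun a => {w ∈ B | G.adj a w}) B
    omega
  have hZB : Z ⊆ B := hZ.trans sdiff_subset
  have hZA : ∀ z ∈ Z, ∀ a ∈ A, G.adj z a := by
    intro z hz a ha
    refine hdom a ha z (hZB hz) fun h => (mem_sdiff.mp (hZ hz)).2 ?_
    exact mem_biUnion.mpr ⟨a, ha, mem_filter.mpr ⟨hZB hz, h⟩⟩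
  obtain ⟨a, ha⟩ : A.Nonempty := card_pos.mp (by omega)
  obtain ⟨X, hX, hX3, hY3, hYa⟩ : ∃ X ⊆ B \ Z, G.IsTTCopy 3 X ∧ G.IsTTCopy 3 ((B \ Z) \ X) ∧
      ∀ y ∈ (B \ Z) \ X, ¬ G.adj a y := by
    obtain ⟨X, hX, hX3, hY3⟩ := hT.exists_isTTCopy_three_sdiff (S := B \ Z)
      (by rw [card_sdiff_of_subset hZB]; omega)
    by_cases hY : ∀ y ∈ (B \ Z) \ X, ¬ G.adj a y
    · exact ⟨X, hX, hX3, hY3, hY⟩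
    · push Not at hY
      obtain ⟨y, hy, hay⟩ := hY
      refine ⟨(B \ Z) \ X, sdiff_subset, hY3, by rwa [Finset.sdiff_sdiff_eq_self hX], ?_⟩
      rw [Finset.sdiff_sdiff_eq_self hX]
      intro x hx hax
      have hxy := card_le_one.mp (hbad a ha) x
        (mem_filter.mpr ⟨(mem_sdiff.mp (hX hx)).1, hax⟩) y
        (mem_filter.mpr ⟨(mem_sdiff.mp (mem_sdiff.mp hy).1).1, hay⟩)
      exact (mem_sdiff.mp hy).2 (hxy ▸ hx)
  have hvA : v ∉ A := by simpa [hA] using G.not_adj_self v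
  have hvB : v ∉ B := by simpa [hB] using G.not_adj_self v
  have hAB : ∀ w ∈ A, w ∉ B := by
    intro w hw hw'
    exact G.asymm w v (by simpa [hA] using hw) (by simpa [hB] using hw')
  have hcover : ∀ w, w = v ∨ w ∈ A ∨ w ∈ B := by
    intro w
    by_cases hw : w = v
    · exact Or.inl hw
    · simpa [hA, hB, hw] using hT w v hw
  refine ⟨{insert v X, insert a ((B \ Z) \ X), Z ∪ A.erase a}, ?_, ?_, ?_⟩
  · simp only [mem_insert, mem_singleton, forall_eq_or_imp, forall_eq]
    refine ⟨hX3.insert_source fun u hu => ?_, hY3.insert_sink fun u hu => ?_, ?_⟩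
    · simpa [hB] using (mem_sdiff.mp (hX hu)).1
    · exact hdom a ha u (mem_sdiff.mp (mem_sdiff.mp hu).1).1 (hYa u hu)
    · refine hT.isTTCopy_union hZ2 (by rw [card_erase_of_mem ha]; omega) ?_
      exact fun z hz w hw => hZA z hz w (mem_of_mem_erase hw)
  · have h₁ : Disjoint (insert v X) (insert a ((B \ Z) \ X)) := by
      rw [disjoint_left]; grind
    have h₂ : Disjoint (insert v X) (Z ∪ A.erase a) := by
      rw [disjoint_left]; grind
    have h₃ : Disjoint (insert a ((B \ Z) \ X)) (Z ∪ A.erase a) := by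
      rw [disjoint_left]; grind
    simp only [coe_insert, coe_singleton]
    simp [Set.pairwiseDisjoint_insert, -disjoint_insert_left, -disjoint_insert_right,
      -disjoint_union_right, h₁, h₂, h₃]
  · ext w
    have := hcover w
    simp only [sup_insert, sup_singleton, id]
    simp only [sup_eq_union]
    grind
end
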